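/- Let G = (N^k, Θ) be a downward directed lattice graph equipped with a family ℱ_G of partial selection functions. The family Q = {ŝ_D : D ⊆ N^k finite} of relaxed selection labeling functions is jump-free: for all finite A, B ⊆ N^k and all x ∈ A ∩ B, if A_x ⊆ B_x and ŝ_A(y) = ŝ_B(y) for all y ∈ A_x, then Φ^A_x ⊆ Φ^B_x and ŝ_A(x) ≥ ŝ_B(x). -/

import Mathlib

namespace LatticeMultiverse

/-- Maximum coordinate value of a lattice point `x ∈ ℕ^k`. -/
noncomputable def vmax {k : ℕ} (x : Fin k → ℕ) : ℕ := sSup (Set.range x)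

/-- Minimum coordinate value of a lattice point `x ∈ ℕ^k`. -/
noncomputable def vmin {k : ℕ} (x : Fin k → ℕ) : ℕ := sInf (Set.range x)

/-- `G = (ℕ^k, Θ)` is a downward directed lattice graph:
every edge `(x, y) ∈ Θ` satisfies `max x > max y`. -/
def Downward {k : ℕ} (Θ : Set ((Fin k → ℕ) × (Fin k → ℕ))) : Prop :=
  ∀ e ∈ Θ, vmax e.2 < vmax e.1

/-- A path in the induced subgraph `G_D`: a nonempty list of distinct vertices of `D`
with consecutive pairs being edges of `Θ` (hence of `Θ_D`). -/
def IsPath {k : ℕ} (Θ : Set ((Fin k → ℕ) × (Fin k → ℕ))) (D : Finset (Fin k → ℕ))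
    (l : List (Fin k → ℕ)) : Prop :=
  l ≠ [] ∧ l.Nodup ∧ (∀ x ∈ l, x ∈ D) ∧ l.Chain' (fun a b => (a, b) ∈ Θ)

/-- A terminal path in `G_D`: a path admitting no one-vertex extension. -/
def IsTerminalPath {k : ℕ} (Θ : Set ((Fin k → ℕ) × (Fin k → ℕ))) (D : Finset (Fin k → ℕ))
    (l : List (Fin k → ℕ)) : Prop :=
  IsPath Θ D l ∧ ∀ y, ¬ IsPath Θ D (l ++ [y])

/-- `T_D(z)`: the set of last vertices of terminal paths in `G_D` starting at `z`. -/
def TD {k : ℕ} (Θ : Set ((Fin k → ℕ) × (Fin k → ℕ))) (D : Finset (Fin k → ℕ))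
    (z : Fin k → ℕ) : Set (Fin k → ℕ) :=
  {w | ∃ l, IsTerminalPath Θ D l ∧ l.head? = some z ∧ l.getLast? = some w}

/-- The terminal label function `t_D(z) = min({min x : x ∈ T_D(z)} ∪ {min z})`. -/
noncomputable def tD {k : ℕ} (Θ : Set ((Fin k → ℕ) × (Fin k → ℕ))) (D : Finset (Fin k → ℕ))
    (z : Fin k → ℕ) : ℕ :=
  sInf (vmin '' TD Θ D z ∪ {vmin z})

open Classical in
/-- The relaxed terminal label function `t̂_D`: `max z` if the one-vertex path `(z)` is
terminal in `G_D`, and `t_D z` otherwise. -/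
noncomputable def tDhat {k : ℕ} (Θ : Set ((Fin k → ℕ) × (Fin k → ℕ))) (D : Finset (Fin k → ℕ))
    (z : Fin k → ℕ) : ℕ :=
  if IsTerminalPath Θ D [z] then vmax z else tD Θ D z

/-- Two `k`-tuples have the same order type. -/
def SameOrderType {k : ℕ} (x y : Fin k → ℕ) : Prop :=
  (∀ i j, x i < x j ↔ y i < y j) ∧ (∀ i j, x i = x j ↔ y i = y j)

/-- The cube `E^k ⊆ ℕ^k`. -/
def cube (k : ℕ) (E : Finset ℕ) : Finset (Fin k → ℕ) := Fintype.piFinset fun _ => E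

/-- `f` is regressively regular over `E^k`: for each order type of `k`-tuples,
either `f x ≥ min x` for all `x ∈ E^k` of that order type, or
`f x = f y < min E` for all `x, y ∈ E^k` of that order type. -/
def RegressivelyRegular {k : ℕ} (E : Finset ℕ) (f : (Fin k → ℕ) → ℕ) : Prop :=
  ∀ x ∈ cube k E,
    (∀ y ∈ cube k E, SameOrderType x y → vmin y ≤ f y) ∨
    (∀ y ∈ cube k E, ∀ z ∈ cube k E, SameOrderType x y → SameOrderType x z →
      f y = f z ∧ f y < sInf (E : Set ℕ))

/-- The set of `f`-significant labels of `S`: `{f z : z ∈ S, f z < min z}`. -/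
def sigLabels {k : ℕ} (f : (Fin k → ℕ) → ℕ) (S : Set (Fin k → ℕ)) : Set ℕ :=
  f '' {z ∈ S | f z < vmin z}

/-- A family of functions with finite domains is encoded as a set of pairs `(D, f)`,
`D` the domain.  Full: every finite `D` is the domain of some member. -/
def FullFam {k : ℕ} (Q : Set (Finset (Fin k → ℕ) × ((Fin k → ℕ) → ℕ))) : Prop :=
  ∀ D, ∃ f, (D, f) ∈ Q

/-- Reflexive: each value `f x`, `x ∈ D`, is a coordinate of some `y ∈ D`. -/
def ReflexiveFam {k : ℕ} (Q : Set (Finset (Fin k → ℕ) × ((Fin k → ℕ) → ℕ))) : Prop :=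
  ∀ p ∈ Q, ∀ x ∈ p.1, ∃ y ∈ p.1, ∃ i, p.2 x = y i

/-- Jump-free: if `x ∈ A ∩ B`, `A_x ⊆ B_x` and `f_A = f_B` on `A_x`, then `f_A x ≥ f_B x`. -/
def JumpFreeFam {k : ℕ} (Q : Set (Finset (Fin k → ℕ) × ((Fin k → ℕ) → ℕ))) : Prop :=
  ∀ A ∈ Q, ∀ B ∈ Q, ∀ x, x ∈ A.1 → x ∈ B.1 →
    (∀ z ∈ A.1, vmax z < vmax x → z ∈ B.1) →
    (∀ y ∈ A.1, vmax y < vmax x → A.2 y = B.2 y) →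
    B.2 x ≤ A.2 x

/-- Friedman's jump-free theorem (independent of ZFC), stated as a proposition to be
assumed as a hypothesis: for every full, reflexive, jump-free family `Q` on `ℕ^k` and
every `p > 0` there are a finite `D`, an `E` with `|E| = p` and `E^k ⊆ D`, and an
`f ∈ Q` with domain `D` that is regressively regular over `E^k`. -/
def JumpFreeTheorem (k : ℕ) : Prop :=
  ∀ Q : Set (Finset (Fin k → ℕ) × ((Fin k → ℕ) → ℕ)),
    FullFam Q → ReflexiveFam Q → JumpFreeFam Q →
    ∀ p : ℕ, 0 < p →
      ∃ D E f, (D, f) ∈ Q ∧ E.card = p ∧ cube k E ⊆ D ∧ RegressivelyRegular E f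

/-- `ℱ_G = {F^x_r}` is a family of partial selection functions on the out-neighborhoods
of `G = (ℕ^k, Θ)`: `F x r` is the partial function `F^x_r : (G^x × ℕ)^r ⇀ ℕ`
(`none` = undefined); whenever defined, its value is one of the `n_i`, and its domain
consists of tuples whose first components are out-neighbors of `x`. -/
def IsSelectionFamily {k : ℕ} (Θ : Set ((Fin k → ℕ) × (Fin k → ℕ)))
    (F : (Fin k → ℕ) → (r : ℕ) → (Fin r → (Fin k → ℕ) × ℕ) → Option ℕ) : Prop :=
  ∀ x r args n, F x r args = some n → (∃ i, n = (args i).2) ∧ ∀ i, (x, (args i).1) ∈ Θ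

/-- `Φ^D_x` relative to a labeling `g`: all defined values
`F^x_r((y₁, g y₁), …, (y_r, g y_r))` with `r ≥ 1` and `y₁, …, y_r ∈ G^x_D`. -/
def Phi {k : ℕ} (Θ : Set ((Fin k → ℕ) × (Fin k → ℕ)))
    (F : (Fin k → ℕ) → (r : ℕ) → (Fin r → (Fin k → ℕ) × ℕ) → Option ℕ)
    (D : Finset (Fin k → ℕ)) (g : (Fin k → ℕ) → ℕ) (x : Fin k → ℕ) : Set ℕ :=
  {n | ∃ r, 1 ≤ r ∧ ∃ y : Fin r → (Fin k → ℕ),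
    ∃ _ : ∀ i, y i ∈ D ∧ (x, y i) ∈ Θ,
    F x r (fun i => (y i, g (y i))) = some n}

open Classical in
/-- The selection labeling function `s_D`, defined by recursion on `vmax x`:
`s_D x = min Φ^D_x` if `Φ^D_x ≠ ∅` (where `Φ^D_x = Phi Θ F D (s_D) x`), and
`s_D x = min x` otherwise. -/
noncomputable def sD {k : ℕ} (Θ : Set ((Fin k → ℕ) × (Fin k → ℕ))) (hΘ : Downward Θ)
    (F : (Fin k → ℕ) → (r : ℕ) → (Fin r → (Fin k → ℕ) × ℕ) → Option ℕ)
    (D : Finset (Fin k → ℕ)) (x : Fin k → ℕ) : ℕ :=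
  let Φ : Set ℕ := {n | ∃ r, 1 ≤ r ∧ ∃ y : Fin r → (Fin k → ℕ),
    ∃ _ : ∀ i, y i ∈ D ∧ (x, y i) ∈ Θ,
    F x r (fun i => (y i, sD Θ hΘ F D (y i))) = some n}
  if Φ.Nonempty then sInf Φ else vmin x
termination_by vmax x
decreasing_by
  have h : ∀ i, y i ∈ D ∧ (x, y i) ∈ Θ := by assumption
  exact hΘ _ (h i).2

open Classical in
/-- The relaxed selection labeling function `ŝ_D`: `s_D x` if `Φ^D_x ≠ ∅`,
and `max x` otherwise. -/
noncomputable def sDhat {k : ℕ} (Θ : Set ((Fin k → ℕ) × (Fin k → ℕ))) (hΘ : Downward Θ)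
    (F : (Fin k → ℕ) → (r : ℕ) → (Fin r → (Fin k → ℕ) × ℕ) → Option ℕ)
    (D : Finset (Fin k → ℕ)) (x : Fin k → ℕ) : ℕ :=
  if (Phi Θ F D (sD Θ hΘ F D) x).Nonempty then sD Θ hΘ F D x else vmax x

/-- The maximal downward edge set `Θ = {(x, y) : max x > max y}`. -/
def maxTheta (k : ℕ) : Set ((Fin k → ℕ) × (Fin k → ℕ)) := {e | vmax e.2 < vmax e.1}

theorem maxTheta_downward (k : ℕ) : Downward (maxTheta k) := fun _ he => he

theorem vmin_le_vmax {k : ℕ} (x : Fin k → ℕ) : vmin x ≤ vmax x := by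
  rcases (Set.range x).eq_empty_or_nonempty with h | ⟨a, ha⟩
  · simp [vmin, vmax, h]
  · exact (Nat.sInf_le ha).trans (le_csSup (Set.finite_range x).bddAbove ha)

open Classical in
/-- Unfolding of the recursion defining `s_D` in terms of `Φ^D_x`. -/
theorem sD_eq {k : ℕ} (Θ : Set ((Fin k → ℕ) × (Fin k → ℕ))) (hΘ : Downward Θ)
    (F : (Fin k → ℕ) → (r : ℕ) → (Fin r → (Fin k → ℕ) × ℕ) → Option ℕ)
    (D : Finset (Fin k → ℕ)) (x : Fin k → ℕ) :
    sD Θ hΘ F D x = if (Phi Θ F D (sD Θ hΘ F D) x).Nonempty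
      then sInf (Phi Θ F D (sD Θ hΘ F D) x) else vmin x := by
  rw [sD]
  rfl

/-- Every value in `Φ^D_x` is the label of an out-neighbor of `x` in `D`. -/
theorem exists_eq_of_mem_Phi {k : ℕ} {Θ : Set ((Fin k → ℕ) × (Fin k → ℕ))}
    {F : (Fin k → ℕ) → (r : ℕ) → (Fin r → (Fin k → ℕ) × ℕ) → Option ℕ}
    (hF : IsSelectionFamily Θ F) {D : Finset (Fin k → ℕ)} {g : (Fin k → ℕ) → ℕ}
    {x : Fin k → ℕ} {n : ℕ} (hn : n ∈ Phi Θ F D g x) :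
    ∃ y ∈ D, (x, y) ∈ Θ ∧ n = g y := by
  obtain ⟨r, -, y, hy, h⟩ := hn
  obtain ⟨⟨i, hi⟩, -⟩ := hF _ _ _ _ h
  exact ⟨y i, (hy i).1, (hy i).2, hi⟩

theorem sD_le_vmax {k : ℕ} {Θ : Set ((Fin k → ℕ) × (Fin k → ℕ))} (hΘ : Downward Θ)
    {F : (Fin k → ℕ) → (r : ℕ) → (Fin r → (Fin k → ℕ) × ℕ) → Option ℕ}
    (hF : IsSelectionFamily Θ F) (D : Finset (Fin k → ℕ)) (x : Fin k → ℕ) :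
    sD Θ hΘ F D x ≤ vmax x := by
  induction h : vmax x using Nat.strong_induction_on generalizing x with
  | _ m ih =>
    subst h
    rw [sD_eq]
    split_ifs with hne
    · obtain ⟨y, -, hxy, hy⟩ := exists_eq_of_mem_Phi hF (Nat.sInf_mem hne)
      rw [hy]
      exact (ih _ (hΘ _ hxy) y rfl).trans (hΘ _ hxy).le
    · exact vmin_le_vmax x

theorem sD_lt_vmax {k : ℕ} {Θ : Set ((Fin k → ℕ) × (Fin k → ℕ))} (hΘ : Downward Θ)
    {F : (Fin k → ℕ) → (r : ℕ) → (Fin r → (Fin k → ℕ) × ℕ) → Option ℕ}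
    (hF : IsSelectionFamily Θ F) {D : Finset (Fin k → ℕ)} {x : Fin k → ℕ}
    (hne : (Phi Θ F D (sD Θ hΘ F D) x).Nonempty) :
    sD Θ hΘ F D x < vmax x := by
  obtain ⟨y, -, hxy, hy⟩ := exists_eq_of_mem_Phi hF (Nat.sInf_mem hne)
  rw [sD_eq, if_pos hne, hy]
  exact (sD_le_vmax hΘ hF D y).trans_lt (hΘ _ hxy)

theorem sDhat_le_vmax {k : ℕ} {Θ : Set ((Fin k → ℕ) × (Fin k → ℕ))} (hΘ : Downward Θ)
    {F : (Fin k → ℕ) → (r : ℕ) → (Fin r → (Fin k → ℕ) × ℕ) → Option ℕ}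
    (hF : IsSelectionFamily Θ F) (D : Finset (Fin k → ℕ)) (x : Fin k → ℕ) :
    sDhat Θ hΘ F D x ≤ vmax x := by
  rw [sDhat]
  split_ifs
  · exact sD_le_vmax hΘ hF D x
  · exact le_rfl

/-- The relaxed label determines the label. -/
theorem sD_eq_of_sDhat_eq {k : ℕ} {Θ : Set ((Fin k → ℕ) × (Fin k → ℕ))} (hΘ : Downward Θ)
    {F : (Fin k → ℕ) → (r : ℕ) → (Fin r → (Fin k → ℕ) × ℕ) → Option ℕ}
    (hF : IsSelectionFamily Θ F) {A B : Finset (Fin k → ℕ)} {y : Fin k → ℕ}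
    (h : sDhat Θ hΘ F A y = sDhat Θ hΘ F B y) :
    sD Θ hΘ F A y = sD Θ hΘ F B y := by
  unfold sDhat at h
  split_ifs at h with hA hB hB
  · exact h
  · exact absurd h (sD_lt_vmax hΘ hF hA).ne
  · exact absurd h.symm (sD_lt_vmax hΘ hF hB).ne
  · rw [sD_eq, if_neg hA, sD_eq, if_neg hB]

/-- The family `Q = {ŝ_D : D ⊆ ℕ^k finite}` of relaxed selection labeling functions is
jump-free: if `x ∈ A ∩ B`, `A_x ⊆ B_x` and `ŝ_A = ŝ_B` on `A_x`, then `Φ^A_x ⊆ Φ^B_x`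
and `ŝ_A x ≥ ŝ_B x`. -/
theorem sDhat_jumpFree {k : ℕ} (hk : 2 ≤ k)
    (Θ : Set ((Fin k → ℕ) × (Fin k → ℕ))) (hΘ : Downward Θ)
    (F : (Fin k → ℕ) → (r : ℕ) → (Fin r → (Fin k → ℕ) × ℕ) → Option ℕ)
    (hF : IsSelectionFamily Θ F)
    (A B : Finset (Fin k → ℕ)) (x : Fin k → ℕ) (hxA : x ∈ A) (hxB : x ∈ B)
    (hAB : ∀ z ∈ A, vmax z < vmax x → z ∈ B)
    (heq : ∀ y ∈ A, vmax y < vmax x → sDhat Θ hΘ F A y = sDhat Θ hΘ F B y) :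
    Phi Θ F A (sD Θ hΘ F A) x ⊆ Phi Θ F B (sD Θ hΘ F B) x ∧
    sDhat Θ hΘ F B x ≤ sDhat Θ hΘ F A x := by
  have hsub : Phi Θ F A (sD Θ hΘ F A) x ⊆ Phi Θ F B (sD Θ hΘ F B) x := by
    rintro n ⟨r, hr, y, hy, h⟩
    have hlt : ∀ i, vmax (y i) < vmax x := fun i => hΘ _ (hy i).2
    refine ⟨r, hr, y, fun i => ⟨hAB _ (hy i).1 (hlt i), (hy i).2⟩, ?_⟩
    rw [← h]
    congr 1
    funext i
    rw [sD_eq_of_sDhat_eq hΘ hF (heq _ (hy i).1 (hlt i))]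
  refine ⟨hsub, ?_⟩
  by_cases hA : (Phi Θ F A (sD Θ hΘ F A) x).Nonempty
  · have hB := hA.mono hsub
    rw [sDhat, if_pos hB, sDhat, if_pos hA, sD_eq, if_pos hB, sD_eq, if_pos hA]
    exact Nat.sInf_le (hsub (Nat.sInf_mem hA))
  · rw [sDhat.eq_def Θ hΘ F A, if_neg hA]
    exact sDhat_le_vmax hΘ hF B x

end LatticeMultiverse
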